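/- Let λ ∈ ℝ and let u, w : ℝ × ℝ → ℝ be smooth functions such that u solves the potential KdV equation ∂_t u = 3(∂_x u)² + ∂_x³ u and the pair (u, w) satisfies the Bäcklund covering equations ∂_x w = λ − ∂_x u − (1/2)(w − u)² and ∂_t w = 2λ² − 2λ ∂_x u − (∂_x u)² − ∂_x³ u + 2(∂_x² u)(w − u) − (λ + ∂_x u)(w − u)² at every point. Then the 1-form (u − w) dx + (2 ∂_x² u − 2(λ + ∂_x u)(w − u)) dt is closed, i.e. ∂_t(u − w) = ∂_x(2 ∂_x² u − 2(λ + ∂_x u)(w − u)) at every point (this is the conservation law of the potential KdV equation arising from the Bäcklund covering). -/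

import Mathlib

open Real

/-- Partial derivative in the first coordinate. -/
noncomputable def pdx (f : ℝ × ℝ → ℝ) (p : ℝ × ℝ) : ℝ := fderiv ℝ f p (1, 0)

/-- Partial derivative in the second coordinate. -/
noncomputable def pdy (f : ℝ × ℝ → ℝ) (p : ℝ × ℝ) : ℝ := fderiv ℝ f p (0, 1)

theorem ContDiff.pdx {f : ℝ × ℝ → ℝ} (hf : ContDiff ℝ (⊤ : ℕ∞) f) :
    ContDiff ℝ (⊤ : ℕ∞) (pdx f) :=
  (hf.fderiv_right (by simp)).clm_apply contDiff_const

/-- The conservation law of the potential KdV equation arising from the Bäcklund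
covering: the 1-form `(u - w) dx + (2u_xx - 2(λ + u_x)(w - u)) dt` is closed. -/
theorem pkdv_backlund_conservation_law
    (lam : ℝ) (u w : ℝ × ℝ → ℝ) (hu : ContDiff ℝ (⊤ : ℕ∞) u) (hw : ContDiff ℝ (⊤ : ℕ∞) w)
    (hpkdv : ∀ p : ℝ × ℝ, pdy u p = 3 * (pdx u p) ^ 2 + pdx (pdx (pdx u)) p)
    (hc1 : ∀ p : ℝ × ℝ,
      pdx w p = lam - pdx u p - (1 / 2) * (w p - u p) ^ 2)
    (hc2 : ∀ p : ℝ × ℝ,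
      pdy w p = 2 * lam ^ 2 - 2 * lam * pdx u p - (pdx u p) ^ 2
        - pdx (pdx (pdx u)) p + 2 * pdx (pdx u) p * (w p - u p)
        - (lam + pdx u p) * (w p - u p) ^ 2) :
    ∀ p : ℝ × ℝ,
      pdy (fun q => u q - w q) p
        = pdx (fun q => 2 * pdx (pdx u) q - 2 * (lam + pdx u q) * (w q - u q)) p := by
  intro p
  have du : DifferentiableAt ℝ u p := hu.differentiable (by simp) p
  have dw : DifferentiableAt ℝ w p := hw.differentiable (by simp) p
  have dux : DifferentiableAt ℝ (pdx u) p := hu.pdx.differentiable (by simp) p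
  have duxx : DifferentiableAt ℝ (pdx (pdx u)) p := hu.pdx.pdx.differentiable (by simp) p
  have lhs : pdy (fun q => u q - w q) p = pdy u p - pdy w p := by
    simp [pdy, fderiv_fun_sub du dw]
  have rhs : pdx (fun q => 2 * pdx (pdx u) q - 2 * (lam + pdx u q) * (w q - u q)) p
      = 2 * pdx (pdx (pdx u)) p
        - (2 * (lam + pdx u p) * (pdx w p - pdx u p)
          + (w p - u p) * (2 * pdx (pdx u) p)) := by
    have h := (duxx.hasFDerivAt.const_mul 2).sub
      (((dux.hasFDerivAt.const_add lam).const_mul 2).mul (dw.hasFDerivAt.sub du.hasFDerivAt))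
    exact congrArg (fun L : ℝ × ℝ →L[ℝ] ℝ => L (1, 0)) h.fderiv
  rw [lhs, rhs, hpkdv, hc1, hc2]
  ring
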